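/- Under RMSProp on L(x) = x^k/k (k ≥ 4 even) with β₂ > ((k-2)/k)^{2(k-2)}, β₂ < 1, and initialization satisfying η x₀^{k-2}/√v₀ < 1 with x₀ > 0, v₀ > 0: the iterates x_t converge to 0 and x_{t+1}/x_t → β₂^{1/(2(k-2))}, i.e., convergence is linear with rate β₂^{1/(2(k-2))}. -/

import Mathlib

open Filter

namespace RMS

lemma polyA (n : ℕ) (p : ℝ) (hp : 0 ≤ p) : ((n : ℝ) + 1) * p ^ n - n * p ^ (n + 1) ≤ 1 := by
  induction n with
  | zero => simp
  | succ n ih =>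
    have h : 0 ≤ ((n : ℝ) + 1) * p ^ n * (1 - p) ^ 2 := by positivity
    push_cast
    have : ((n : ℝ) + 1 + 1) * p ^ (n + 1) - ((n : ℝ) + 1) * p ^ (n + 1 + 1)
      = ((n : ℝ) + 1) * p ^ n - n * p ^ (n + 1) - ((n : ℝ) + 1) * p ^ n * (1 - p) ^ 2 := by ring
    linarith

lemma polyH_step (n : ℕ) (p : ℝ) :
    ((n : ℝ) + 1 + 2) * p ^ (n + 1 + 1) - ((n : ℝ) + 1) * p ^ (n + 1 + 2) + ((n : ℝ) + 1)
      - ((n : ℝ) + 1 + 2) * p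
    = (((n : ℝ) + 2) * p ^ (n + 1) - n * p ^ (n + 2) + n - ((n : ℝ) + 2) * p)
      + (1 - p) * (1 - (((n : ℝ) + 1 + 1) * p ^ (n + 1) - ((n : ℝ) + 1) * p ^ (n + 1 + 1))) := by
  ring

lemma polyH_nonneg (n : ℕ) (p : ℝ) (hp : 0 ≤ p) (hp1 : p ≤ 1) :
    0 ≤ ((n : ℝ) + 2) * p ^ (n + 1) - n * p ^ (n + 2) + n - ((n : ℝ) + 2) * p := by
  induction n with
  | zero => simp
  | succ n ih =>
    have hA := polyA (n + 1) p hp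
    push_cast at hA ⊢
    rw [polyH_step]
    have := mul_nonneg (sub_nonneg.2 hp1) (sub_nonneg.2 hA)
    linarith

lemma polyH_nonpos (n : ℕ) (p : ℝ) (hp1 : 1 ≤ p) :
    ((n : ℝ) + 2) * p ^ (n + 1) - n * p ^ (n + 2) + n - ((n : ℝ) + 2) * p ≤ 0 := by
  induction n with
  | zero => simp
  | succ n ih =>
    have hA := polyA (n + 1) p (by linarith)
    push_cast at hA ⊢
    rw [polyH_step]
    have := mul_nonneg (sub_nonneg.2 hp1) (sub_nonneg.2 hA)
    linarith

/-- coordinate in which the enveloping involution is a reflection -/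
noncomputable def h (n y : ℝ) : ℝ := y / max (n - y) (n / 2)

lemma h_mono {n : ℝ} (hn : 0 < n) {x y : ℝ} (hxy : x < y) : h n x < h n y := by
  unfold h
  have hx : 0 < max (n - x) (n / 2) := lt_max_of_lt_right (by linarith)
  have hy : 0 < max (n - y) (n / 2) := lt_max_of_lt_right (by linarith)
  rw [div_lt_div_iff₀ hx hy]
  rcases le_total (n - x) (n / 2) with h1 | h1 <;> rcases le_total (n - y) (n / 2) with h2 | h2
  · rw [max_eq_right h1, max_eq_right h2]; nlinarith
  · linarith
  · rw [max_eq_left h1, max_eq_right h2]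
    nlinarith
  · rw [max_eq_left h1, max_eq_left h2]; nlinarith

lemma h_phi {n y : ℝ} (hn : 0 < n) (hy : y < n / 2) : h n (-y / (1 - 2 * y / n)) = - h n y := by
  unfold h
  have hp : 0 < 1 - 2 * y / n := by
    rw [sub_pos, div_lt_one hn]; linarith
  have e : n - -y / (1 - 2 * y / n) = (n - y) / (1 - 2 * y / n) := by
    have e0 : n * (1 - 2 * y / n) = n - 2 * y := by field_simp
    rw [eq_div_iff hp.ne', sub_mul, div_mul_cancel₀ _ hp.ne', e0]; ring
  have e1 : n / 2 ≤ (n - y) / (1 - 2 * y / n) := by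
    rw [le_div_iff₀ hp]
    have : n / 2 * (1 - 2 * y / n) = n / 2 - y := by field_simp
    linarith
  rw [e, max_eq_left e1, max_eq_left (by linarith : n / 2 ≤ n - y)]
  rw [div_div_div_cancel_right₀ hp.ne', neg_div]

lemma core (n : ℕ) (hn : 0 < n) (b y : ℝ) (hb : 0 < b) (hb2 : n * b < 2) (hy : -1 < y)
    (hy0 : y ≠ 0) (hyb : b * y < 1) :
    |h n ((1 + y) * (1 - b * y) ^ n - 1)| < |h n y| := by
  have hn' : (0 : ℝ) < n := by exact_mod_cast hn
  have h0 : h n 0 = 0 := by simp [h]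
  set p : ℝ := 1 - 2 * y / n with hpdef
  have hyp : y = n * (1 - p) / 2 := by rw [hpdef]; field_simp; ring
  have hb3 : b < 2 / n := by rw [lt_div_iff₀ hn']; linarith
  have e2 : 2 * y / n = 2 / n * y := by ring
  rcases lt_or_gt_of_ne hy0 with hneg | hpos
  · have hp1 : 1 < p := by
      rw [hpdef]; have : 2 * y / n < 0 := div_neg_of_neg_of_pos (by linarith) hn'
      linarith
    have hbp : 1 - b * y < p := by rw [hpdef, e2]; nlinarith
    have hb1 : 1 < 1 - b * y := by nlinarith
    have hpow : (1 - b * y) ^ n < p ^ n := pow_lt_pow_left₀ hbp (by linarith) hn.ne'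
    have hpow1 : 1 < (1 - b * y) ^ n := one_lt_pow₀ hb1 hn.ne'
    have hH := polyH_nonpos n p hp1.le
    have hle : (1 + y) * p ^ n - 1 ≤ -y / p := by
      rw [le_div_iff₀ (by linarith)]
      have : ((1 + y) * p ^ n - 1) * p + y = ((n + 2) * p ^ (n + 1) - n * p ^ (n + 2) + n - (n + 2) * p) / 2 := by
        rw [hyp]; ring
      linarith
    have l1 : (1 + y) * (1 - b * y) ^ n - 1 < -y / p := by nlinarith
    have l2 : y < (1 + y) * (1 - b * y) ^ n - 1 := by nlinarith
    have m1 := h_mono hn' l1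
    have m2 := h_mono hn' l2
    rw [hpdef, h_phi hn' (by linarith)] at m1
    have m0 := h_mono hn' hneg
    rw [h0] at m0
    rw [abs_of_neg m0, abs_lt]
    constructor <;> linarith
  · have m0 := h_mono hn' hpos
    rw [h0] at m0
    have hb1 : 1 - b * y < 1 := by nlinarith
    have hpow1 : (1 - b * y) ^ n < 1 := pow_lt_one₀ (by linarith) hb1 hn.ne'
    have hpow0 : 0 < (1 - b * y) ^ n := pow_pos (by linarith) n
    have l2 : (1 + y) * (1 - b * y) ^ n - 1 < y := by nlinarith
    have m2 := h_mono hn' l2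
    rw [abs_of_pos m0, abs_lt]
    refine ⟨?_, m2⟩
    rcases lt_or_ge y (n / 2) with hlt | hge
    · have hp0 : 0 < p := by
        rw [hpdef, sub_pos, div_lt_one hn']; linarith
      have hp1 : p < 1 := by
        rw [hpdef]; have : 0 < 2 * y / n := by positivity
        linarith
      have hbp : p < 1 - b * y := by rw [hpdef, e2]; nlinarith
      have hpow : p ^ n < (1 - b * y) ^ n := pow_lt_pow_left₀ hbp (by linarith) hn.ne'
      have hH := polyH_nonneg n p hp0.le hp1.le
      have hle : -y / p ≤ (1 + y) * p ^ n - 1 := by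
        rw [div_le_iff₀ hp0]
        have : ((1 + y) * p ^ n - 1) * p + y = ((n + 2) * p ^ (n + 1) - n * p ^ (n + 2) + n - (n + 2) * p) / 2 := by
          rw [hyp]; ring
        linarith
      have l1 : -y / p < (1 + y) * (1 - b * y) ^ n - 1 := by nlinarith
      have m1 := h_mono hn' l1
      rw [hpdef, h_phi hn' hlt] at m1
      exact m1
    · have l1 : -1 < (1 + y) * (1 - b * y) ^ n - 1 := by
        have : 0 < (1 + y) * (1 - b * y) ^ n := by nlinarith
        linarith
      have m1 := h_mono hn' l1
      have a1 : -1 < h n (-1) := by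
        unfold h
        rw [lt_div_iff₀ (lt_max_of_lt_right (by linarith))]
        have := le_max_left ((n : ℝ) - -1) (n / 2)
        linarith
      have a2 : 1 ≤ h n y := by
        unfold h
        rw [max_eq_right (by linarith), le_div_iff₀ (by linarith)]
        linarith
      linarith

lemma conv (K : Set ℝ) (hK : IsCompact K) (f V : ℝ → ℝ) (hf : Continuous f) (hV : Continuous V)
    (c : ℝ) (hV0 : ∀ u, u ≠ c → 0 < V u) (hVc : V c = 0) (hfc : f c = c)
    (hdec : ∀ u ∈ K, u ≠ c → V (f u) < V u)
    (u : ℕ → ℝ) (hu : ∀ᶠ t in atTop, u t ∈ K)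
    (hlim : Tendsto (fun t => u (t + 1) - f (u t)) atTop (nhds 0)) :
    Tendsto u atTop (nhds c) := by
  have hVnn : ∀ u, 0 ≤ V u := fun u => by
    by_cases h : u = c
    · rw [h, hVc]
    · exact (hV0 u h).le
  -- V (u (t+1)) - V (f (u t)) → 0
  have hd : ∀ δ > 0, ∀ᶠ t in atTop, V (u (t + 1)) < V (f (u t)) + δ := by
    intro δ hδ
    set K2 : Set ℝ := K ∪ f '' K with hK2
    have hK2c : IsCompact K2 := hK.union (hK.image hf)
    have huc := hK2c.uniformContinuousOn_of_continuous hV.continuousOn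
    rw [Metric.uniformContinuousOn_iff] at huc
    obtain ⟨e, he, H⟩ := huc δ hδ
    have hu1 : ∀ᶠ t in atTop, u (t + 1) ∈ K := (tendsto_add_atTop_nat 1).eventually hu
    rw [Metric.tendsto_atTop] at hlim
    obtain ⟨N, hN⟩ := hlim e he
    filter_upwards [hu, hu1, eventually_ge_atTop N] with t h1 h2 h3
    have h4 := hN t h3
    rw [Real.dist_eq, sub_zero] at h4
    have := H (u (t + 1)) (Or.inl h2) (f (u t)) (Or.inr ⟨_, h1, rfl⟩) (by rwa [Real.dist_eq])
    rw [Real.dist_eq, abs_lt] at this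
    linarith
  -- V (u t) small
  have hsmall : ∀ ε > 0, ∀ᶠ t in atTop, V (u t) < 2 * ε := by
    intro ε hε
    obtain ⟨δ, hδ, hδε, hδK⟩ : ∃ δ > 0, δ ≤ ε ∧ ∀ w ∈ K, ε ≤ V w → V (f w) + 2 * δ ≤ V w := by
      have hc : IsCompact (K ∩ {w | ε ≤ V w}) := hK.inter_right (isClosed_le continuous_const hV)
      rcases (K ∩ {w | ε ≤ V w}).eq_empty_or_nonempty with he | hne
      · refine ⟨ε, hε, le_rfl, fun w hw hw' => ?_⟩
        have : w ∈ K ∩ {w | ε ≤ V w} := ⟨hw, hw'⟩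
        rw [he] at this; exact this.elim
      · obtain ⟨w0, hw0, hmin⟩ := hc.exists_isMinOn hne
          (f := fun w => V w - V (f w)) (by fun_prop)
        have hw0c : w0 ≠ c := by
          rintro rfl
          have := hw0.2
          simp only [Set.mem_ofPred_eq, hVc] at this
          linarith
        have hp := hdec w0 hw0.1 hw0c
        refine ⟨min ε ((V w0 - V (f w0)) / 2), lt_min hε (by linarith), min_le_left _ _,
          fun w hw hw' => ?_⟩
        have h1 : V w0 - V (f w0) ≤ V w - V (f w) := hmin (show w ∈ K ∩ {w | ε ≤ V w} from ⟨hw, hw'⟩)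
        have h2 := min_le_right ε ((V w0 - V (f w0)) / 2)
        linarith
    obtain ⟨N, hN⟩ := eventually_atTop.1 ((hd δ hδ).and hu)
    have hle : ∀ t ≥ N, V (f (u t)) ≤ V (u t) := fun t ht => by
      by_cases h : u t = c
      · rw [h, hfc]
      · exact (hdec _ (hN t ht).2 h).le
    -- some time below
    have hex : ∃ T ≥ N, V (u T) < ε + δ := by
      by_contra! hcon
      have hind : ∀ j : ℕ, V (u (N + j)) ≤ V (u N) - j * δ := by
        intro j
        induction j with
        | zero => simp
        | succ j ih =>
          have h1 := hN (N + j) (by omega)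
          have h2 := hcon (N + j) (by omega)
          have h3 := hδK _ h1.2 (by linarith)
          have h4 := h1.1
          push_cast
          rw [show N + (j + 1) = N + j + 1 by ring]
          linarith
      obtain ⟨j, hj⟩ := exists_nat_gt (V (u N) / δ)
      rw [div_lt_iff₀ hδ] at hj
      have := hind j
      have := hVnn (u (N + j))
      linarith
    obtain ⟨T, hT, hTV⟩ := hex
    rw [eventually_atTop]
    refine ⟨T, fun t ht => ?_⟩
    have : V (u t) < ε + δ := by
      induction t, ht using Nat.le_induction with
      | base => exact hTV
      | succ t ht ih =>
        have h1 := hN t (by omega)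
        rcases lt_or_ge (V (u t)) ε with h | h
        · have := hle t (by omega); linarith [h1.1]
        · have := hδK _ h1.2 h; linarith [h1.1]
    linarith
  rw [Metric.tendsto_atTop']
  intro ε hε
  have hc : IsCompact (K ∩ {w | ε ≤ |w - c|}) :=
    hK.inter_right (isClosed_le continuous_const (by fun_prop))
  rcases (K ∩ {w | ε ≤ |w - c|}).eq_empty_or_nonempty with he | hne
  · obtain ⟨N, hN⟩ := eventually_atTop.1 hu
    refine ⟨N, fun t ht => ?_⟩
    by_contra hcon
    rw [Real.dist_eq, not_lt] at hcon
    have : u t ∈ K ∩ {w | ε ≤ |w - c|} := ⟨hN t ht.le, hcon⟩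
    rw [he] at this; exact this
  · obtain ⟨w0, hw0, hmin⟩ := hc.exists_isMinOn hne (f := V) hV.continuousOn
    have hw0c : w0 ≠ c := by
      rintro rfl
      have := hw0.2
      simp at this
      linarith
    have hp := hV0 w0 hw0c
    obtain ⟨N, hN⟩ := eventually_atTop.1 (hu.and (hsmall (V w0 / 2) (by linarith)))
    refine ⟨N, fun t ht => ?_⟩
    by_contra hcon
    rw [Real.dist_eq, not_lt] at hcon
    have h1 : V w0 ≤ V (u t) := hmin (show u t ∈ K ∩ {w | ε ≤ |w - c|} from ⟨(hN t ht.le).1, hcon⟩)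
    have := (hN t ht.le).2
    linarith

/-- convergence of the perturbed scalar recursion -/
lemma scalar (n : ℕ) (hn : 2 ≤ n) (q : ℝ) (hq1 : q < 1) (hq : (n : ℝ) / (n + 2) < q)
    (u r : ℕ → ℝ) (hu0 : ∀ t, 0 < u t) (hu1 : ∀ t, u t < 1)
    (hr0 : ∀ t, r t ≤ 1) (hr : Tendsto r atTop (nhds 1))
    (hrec : ∀ t, u (t + 1) = u t * (1 - u t) ^ n / q ^ n * r t)
    (hlt : ∀ w : ℝ, 0 ≤ w → w ≤ 1 → w * (1 - w) ^ n / q ^ n < 1) :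
    Tendsto u atTop (nhds (1 - q)) := by
  have hn' : (0 : ℝ) < n := by exact_mod_cast (by omega : 0 < n)
  have hq0 : 0 < q := lt_trans (by positivity) hq
  have hqn : 0 < q ^ n := by positivity
  have hc0 : 0 < 1 - q := by linarith
  set f : ℝ → ℝ := fun w => w * (1 - w) ^ n / q ^ n with hf
  have hfc : Continuous f := by fun_prop
  obtain ⟨w0, hw0, hmax⟩ := (isCompact_Icc (a := (0 : ℝ)) (b := 1)).exists_isMaxOn
    ⟨0, by simp⟩ hfc.continuousOn
  set M := f w0 with hM
  have hM1 : M < 1 := hlt w0 hw0.1 hw0.2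
  have hfM : ∀ w, 0 ≤ w → w ≤ 1 → f w ≤ M := fun w h1 h2 => hmax ⟨h1, h2⟩
  have hf0 : ∀ t, 0 < f (u t) := fun t => by
    have := hu0 t
    have : 0 < 1 - u t := by linarith [hu1 t]
    simp only [hf]; positivity
  have hrec' : ∀ t, u (t + 1) = f (u t) * r t := hrec
  have huM : ∀ t, u (t + 1) ≤ M := fun t => by
    rw [hrec']
    have := hfM (u t) (hu0 t).le (hu1 t).le
    nlinarith [hr0 t, hf0 t]
  -- lower bound
  obtain ⟨ε, hε, hεu⟩ : ∃ ε > 0, ∀ᶠ t in atTop, ε ≤ u t := by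
    set g := (1 - (1 - q) / 2) ^ n / q ^ n with hg
    have hg1 : 1 < g := by
      rw [hg, one_lt_div hqn]
      exact pow_lt_pow_left₀ (by linarith) hq0.le (by omega)
    have hginv : g⁻¹ < 1 := inv_lt_one_of_one_lt₀ hg1
    have hgp : 0 < g⁻¹ := by positivity
    have hev : ∀ᶠ t in atTop, g⁻¹ < r t := hr.eventually_const_lt hginv
    obtain ⟨N, hN⟩ := eventually_atTop.1 hev
    set ε1 := (1 - q) / 2 * ((1 - M) ^ n / q ^ n) * g⁻¹ with hε1
    have h1M : 0 < 1 - M := by linarith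
    have hε1p : 0 < ε1 := by positivity
    refine ⟨min (u (N + 1)) (min ((1 - q) / 2) ε1), lt_min (hu0 _) (lt_min (by linarith) hε1p), ?_⟩
    rw [eventually_atTop]
    refine ⟨N + 1, fun t ht => ?_⟩
    induction t, ht using Nat.le_induction with
    | base => exact min_le_left _ _
    | succ t ht ih =>
      have hrt := hN t (by omega)
      have hut := hu0 t
      have hutM : u t ≤ M := by
        obtain ⟨s, rfl⟩ : ∃ s, t = s + 1 := ⟨t - 1, by omega⟩
        exact huM s
      have hfe : f (u t) = u t * ((1 - u t) ^ n / q ^ n) := by simp only [hf]; ring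
      have h1u : 0 < 1 - u t := by linarith
      have hnn : 0 ≤ (1 - u t) ^ n / q ^ n := by positivity
      have hnn2 : 0 ≤ u t * ((1 - u t) ^ n / q ^ n) := by positivity
      rcases le_total (u t) ((1 - q) / 2) with h | h
      · refine ih.trans ?_
        have h1 : g ≤ (1 - u t) ^ n / q ^ n := by
          rw [hg]; gcongr
          linarith
        rw [hrec', hfe]
        have h2 : 1 ≤ (1 - u t) ^ n / q ^ n * r t := by
          calc (1 : ℝ) = g * g⁻¹ := by field_simp
            _ ≤ _ := by gcongr
        nlinarith
      · refine (min_le_right _ _).trans ((min_le_right _ _).trans ?_)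
        rw [hrec', hfe, hε1]
        gcongr
  -- apply conv
  set b := (1 - q) / q with hb
  set V : ℝ → ℝ := fun w => |h n (w / (1 - q) - 1)| with hV
  have hhc : Continuous (h n) := by
    unfold h
    refine Continuous.div (by fun_prop) (by fun_prop) fun y => ?_
    exact (lt_max_of_lt_right (by linarith)).ne'
  have h0 : h n 0 = 0 := by simp [h]
  refine conv (Set.Icc ε M) isCompact_Icc f V hfc (by fun_prop) (1 - q) ?_ ?_ ?_ ?_ u ?_ ?_
  · intro w hw
    simp only [hV]
    rw [abs_pos]
    have : w / (1 - q) - 1 ≠ 0 := by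
      rw [sub_ne_zero]; intro h; rw [div_eq_one_iff_eq hc0.ne'] at h; exact hw h
    unfold h
    exact div_ne_zero this (lt_max_of_lt_right (by linarith)).ne'
  · simp only [hV]
    rw [div_self hc0.ne', sub_self, h0, abs_zero]
  · simp only [hf]
    rw [sub_sub_cancel]; field_simp
  · intro w hw hwc
    have hw0 : 0 < w := lt_of_lt_of_le hε hw.1
    have hw1 : w < 1 := lt_of_le_of_lt hw.2 hM1
    have e1 : 1 - b * (w / (1 - q) - 1) = (1 - w) / q := by
      rw [hb]; field_simp; ring
    have := core n (by omega) b (w / (1 - q) - 1) (by positivity) ?_ ?_ ?_ ?_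
    · simp only [hV, hf]
      convert this using 3
      rw [e1, div_pow]; field_simp; ring
    · rw [hb, mul_div_assoc', div_lt_iff₀ hq0]
      rw [div_lt_iff₀ (by linarith)] at hq
      linarith
    · have : 0 < w / (1 - q) := by positivity
      linarith
    · rw [sub_ne_zero]; intro h; rw [div_eq_one_iff_eq hc0.ne'] at h; exact hwc h
    · have : 0 < (1 - w) / q := div_pos (by linarith) hq0
      linarith
  · filter_upwards [hεu, eventually_ge_atTop 1] with t h1 h2
    obtain ⟨s, rfl⟩ : ∃ s, t = s + 1 := ⟨t - 1, by omega⟩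
    exact ⟨h1, huM s⟩
  · have h1 : Tendsto (fun t => 1 - r t) atTop (nhds 0) := by
      simpa using hr.const_sub 1
    refine squeeze_zero_norm (fun t => ?_) h1
    rw [hrec', Real.norm_eq_abs, abs_le]
    have := hfM (u t) (hu0 t).le (hu1 t).le
    constructor <;> nlinarith [hr0 t, hf0 t]

lemma max_bound (n : ℕ) (hn : 2 ≤ n) (q : ℝ) (hq : (n : ℝ) / (n + 2) < q)
    (w : ℝ) (hw0 : 0 ≤ w) (hw1 : w ≤ 1) : w * (1 - w) ^ n / q ^ n < 1 := by
  have hn' : (0 : ℝ) < n := by exact_mod_cast (by omega : 0 < n)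
  have hd0 : 0 < (n : ℝ) / (n + 2) := by positivity
  rw [div_lt_one (pow_pos (hd0.trans hq) n)]
  have h1 : ((n : ℝ) / (n + 2)) ^ n < q ^ n := pow_lt_pow_left₀ hq hd0.le (by omega)
  refine lt_of_le_of_lt ?_ h1
  have hA := polyA n ((1 - w) * ((n + 1) / n)) (mul_nonneg (by linarith) (by positivity))
  have hB := polyA n (((n : ℝ) + 2) / (n + 1)) (by positivity)
  have eA : ((n : ℝ) + 1) * ((1 - w) * ((n + 1) / n)) ^ n - n * ((1 - w) * ((n + 1) / n)) ^ (n + 1)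
      = w * (1 - w) ^ n * ((n + 1) * ((n + 1) / n) ^ n) := by
    rw [pow_succ, mul_pow]; field_simp; ring
  have eB : ((n : ℝ) + 1) * (((n : ℝ) + 2) / (n + 1)) ^ n - n * (((n : ℝ) + 2) / (n + 1)) ^ (n + 1)
      = (((n : ℝ) + 2) / (n + 1)) ^ n / (n + 1) := by
    rw [pow_succ]; field_simp; ring
  rw [eA] at hA
  rw [eB, div_le_one (by positivity)] at hB
  have e3 : ((n : ℝ) / (n + 2)) ^ n * ((((n : ℝ) + 2) / (n + 1)) ^ n * ((n + 1) / n) ^ n) = 1 := by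
    rw [← mul_pow, ← mul_pow]
    have : (n : ℝ) / (n + 2) * ((n + 2) / (n + 1) * ((n + 1) / n)) = 1 := by field_simp
    rw [this, one_pow]
  set X := w * (1 - w) ^ n
  set A := (((n : ℝ) + 1) / n) ^ n with hAd
  set B := (((n : ℝ) + 2) / (n + 1)) ^ n
  set D := ((n : ℝ) / (n + 2)) ^ n with hD
  have hDp : 0 < D := pow_pos hd0 n
  have hAp : 0 < A := by positivity
  have hX : 0 ≤ X := mul_nonneg hw0 (pow_nonneg (by linarith) n)
  have h5 : X * (B * A) ≤ 1 := by
    refine le_trans ?_ hA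
    gcongr
  have : X = X * (B * A) * D := by linear_combination (-X) * e3
  rw [this]
  nlinarith

end RMS

/-- Global linear convergence of RMSProp on `L(x) = x^k/k`: under
`β₂ > ((k-2)/k)^{2(k-2)}` and `η x₀^{k-2}/√v₀ < 1`, the iterates converge to `0` with
linear rate `β₂^{1/(2(k-2))}`. -/
theorem stmt_12 (k : ℕ) (hk : 4 ≤ k) (hke : Even k) (η β₂ : ℝ) (hη : 0 < η)
    (hβ1 : β₂ < 1) (hβ2 : (((k : ℝ) - 2) / (k : ℝ)) ^ (2 * (k - 2)) < β₂)
    (x v : ℕ → ℝ) (hx0 : 0 < x 0) (hv0 : 0 < v 0)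
    (hinit : η * (x 0) ^ (k - 2) / Real.sqrt (v 0) < 1)
    (hxrec : ∀ t, x (t + 1) = x t - η * (x t) ^ (k - 1) / Real.sqrt (v t))
    (hvrec : ∀ t, v (t + 1) = β₂ * v t + (1 - β₂) * (x (t + 1)) ^ (2 * k - 2)) :
    Tendsto x atTop (nhds 0) ∧
    Tendsto (fun t => x (t + 1) / x t) atTop
      (nhds (β₂ ^ ((1 : ℝ) / (2 * ((k : ℝ) - 2))))) := by
  obtain ⟨n, rfl⟩ : ∃ n, k = n + 2 := ⟨k - 2, by omega⟩
  have hn : 2 ≤ n := by omega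
  have hn' : (0 : ℝ) < n := by exact_mod_cast (by omega : 0 < n)
  rw [show n + 2 - 2 = n by omega] at *
  rw [show ((n + 2 : ℕ) : ℝ) - 2 = n by push_cast; ring] at *
  simp only [show n + 2 - 1 = n + 1 by omega] at hxrec
  simp only [show 2 * (n + 2) - 2 = 2 * (n + 1) by omega] at hvrec
  push_cast at hβ2
  have hβ0 : 0 < β₂ := lt_of_le_of_lt (by positivity) hβ2
  set q := β₂ ^ ((1 : ℝ) / (2 * (n : ℝ))) with hqdef
  have hq0 : 0 < q := Real.rpow_pos_of_pos hβ0 _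
  have hq2n : q ^ (2 * n) = β₂ := by
    rw [hqdef, ← Real.rpow_natCast, ← Real.rpow_mul hβ0.le]
    push_cast
    rw [one_div_mul_cancel (by positivity), Real.rpow_one]
  have hq1 : q < 1 := Real.rpow_lt_one hβ0.le hβ1 (by positivity)
  have hq : (n : ℝ) / (n + 2) < q := by
    rw [← hq2n] at hβ2
    exact lt_of_pow_lt_pow_left₀ _ hq0.le hβ2
  have hsqβ : Real.sqrt β₂ = q ^ n := by
    rw [← hq2n, mul_comm, pow_mul, Real.sqrt_sq (by positivity)]
  set u : ℕ → ℝ := fun t => η * x t ^ n / Real.sqrt (v t) with hu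
  have hxu : ∀ t, x (t + 1) = x t * (1 - u t) := fun t => by
    rw [hxrec, hu]; ring
  set r : ℕ → ℝ := fun t => Real.sqrt (1 - (1 - β₂) * (x (t + 1) ^ 2 * u (t + 1) ^ 2 / η ^ 2)) with hr
  have hb : ∀ w, 0 ≤ w → w ≤ 1 → w * (1 - w) ^ n / q ^ n < 1 := RMS.max_bound n hn q hq
  have hr1 : ∀ t, r t ≤ 1 := fun t => by
    simp only [hr]
    refine Real.sqrt_le_one.2 ?_
    have : 0 ≤ (1 - β₂) * (x (t + 1) ^ 2 * u (t + 1) ^ 2 / η ^ 2) :=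
      mul_nonneg (by linarith) (by positivity)
    linarith
  have hvpos : ∀ t, 0 < v t := by
    intro t
    induction t with
    | zero => exact hv0
    | succ t ih =>
      rw [hvrec]
      have : 0 ≤ (1 - β₂) * x (t + 1) ^ (2 * (n + 1)) :=
        mul_nonneg (by linarith) (by rw [pow_mul']; positivity)
      have : 0 < β₂ * v t := by positivity
      linarith
  have hrec : ∀ t, u (t + 1) = u t * (1 - u t) ^ n / q ^ n * r t := by
    intro t
    have hv := hvpos t
    have hv1 := hvpos (t + 1)
    have hs := Real.sqrt_pos.2 hv
    have hs1 := Real.sqrt_pos.2 hv1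
    have e1 : r t = q ^ n * Real.sqrt (v t) / Real.sqrt (v (t + 1)) := by
      rw [← hsqβ, ← Real.sqrt_mul hβ0.le, ← Real.sqrt_div (by positivity)]
      simp only [hr]
      congr 1
      have e2 : u (t + 1) ^ 2 = η ^ 2 * x (t + 1) ^ (2 * n) / v (t + 1) := by
        simp only [hu]
        rw [div_pow, Real.sq_sqrt hv1.le]; ring
      rw [e2, eq_div_iff hv1.ne']
      have e3 := hvrec t
      field_simp
      rw [show 2 * (n + 1) = 2 + 2 * n by ring, pow_add] at e3
      linear_combination e3
    have e4 : u (t + 1) = η * (x t * (1 - u t)) ^ n / Real.sqrt (v (t + 1)) := by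
      rw [← hxu]
    rw [e4, e1, mul_pow]
    have e5 : u t * Real.sqrt (v t) = η * x t ^ n := by
      simp only [hu]; field_simp
    field_simp
    linear_combination -(1 - u t) ^ n * e5
  have hpos : ∀ t, 0 < x t ∧ u t < 1 := by
    intro t
    induction t with
    | zero => exact ⟨hx0, hinit⟩
    | succ t ih =>
      have hut : 0 < u t := div_pos (mul_pos hη (pow_pos ih.1 n)) (Real.sqrt_pos.2 (hvpos t))
      refine ⟨?_, ?_⟩
      · rw [hxu]; exact mul_pos ih.1 (by linarith [ih.2])
      · rw [hrec]
        have h1 := hb (u t) hut.le ih.2.le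
        have h2 : 0 ≤ u t * (1 - u t) ^ n / q ^ n :=
          div_nonneg (mul_nonneg hut.le (pow_nonneg (by linarith [ih.2]) n)) (by positivity)
        nlinarith [hr1 t]
  have hxpos := fun t => (hpos t).1
  have hu1 := fun t => (hpos t).2
  have hu0 : ∀ t, 0 < u t := fun t =>
    div_pos (mul_pos hη (pow_pos (hxpos t) n)) (Real.sqrt_pos.2 (hvpos t))
  have hanti : Antitone x := antitone_nat_of_succ_le fun t => by
    rw [hxu]; nlinarith [hxpos t, hu0 t]
  have hxlim : Tendsto x atTop (nhds 0) := by
    have hbdd : BddBelow (Set.range x) := ⟨0, by rintro _ ⟨t, rfl⟩; exact (hxpos t).le⟩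
    have hL := tendsto_atTop_ciInf hanti hbdd
    set L := ⨅ t, x t with hLd
    have hL0 : 0 ≤ L := le_ciInf fun t => (hxpos t).le
    have hLle : ∀ t, L ≤ x t := fun t => ciInf_le hbdd t
    rcases hL0.eq_or_lt with h | h
    · rwa [← h] at hL
    · exfalso
      set B := max (v 0) (x 0 ^ (2 * (n + 1))) with hB
      have hvB : ∀ t, v t ≤ B := by
        intro t
        induction t with
        | zero => exact le_max_left _ _
        | succ t ih =>
          have h1 : x (t + 1) ^ (2 * (n + 1)) ≤ B :=
            (pow_le_pow_left₀ (hxpos _).le (hanti (Nat.zero_le _)) _).trans (le_max_right _ _)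
          rw [hvrec]; nlinarith
      have hBp : 0 < B := lt_of_lt_of_le hv0 (le_max_left _ _)
      have hd : ∀ t, η * L ^ (n + 1) / Real.sqrt B ≤ x t - x (t + 1) := fun t => by
        rw [hxrec, sub_sub_cancel]
        have := Real.sqrt_pos.2 (hvpos t)
        have := hxpos t
        have := hLle t
        have := Real.sqrt_le_sqrt (hvB t)
        gcongr
      have hz : Tendsto (fun t => x t - x (t + 1)) atTop (nhds (L - L)) :=
        hL.sub (hL.comp (tendsto_add_atTop_nat 1))
      have := ge_of_tendsto' hz hd
      have : 0 < η * L ^ (n + 1) / Real.sqrt B :=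
        div_pos (by positivity) (Real.sqrt_pos.2 hBp)
      linarith
  refine ⟨hxlim, ?_⟩
  have hrlim : Tendsto r atTop (nhds 1) := by
    have h1 : Tendsto (fun t => x (t + 1) ^ 2 * u (t + 1) ^ 2 / η ^ 2) atTop (nhds 0) := by
      have h2 : Tendsto (fun t => x (t + 1) ^ 2 / η ^ 2) atTop (nhds 0) := by
        have := ((hxlim.comp (tendsto_add_atTop_nat 1)).pow 2).div_const (η ^ 2)
        simpa using this
      refine squeeze_zero (fun t => by positivity) (fun t => ?_) h2
      have h3 : u (t + 1) ^ 2 ≤ 1 := pow_le_one₀ (hu0 _).le (hu1 _).le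
      have h4 : x (t + 1) ^ 2 * u (t + 1) ^ 2 ≤ x (t + 1) ^ 2 :=
        mul_le_of_le_one_right (by positivity) h3
      gcongr
    have h5 := ((h1.const_mul (1 - β₂)).const_sub 1).sqrt
    simpa using h5
  have hulim := RMS.scalar n hn q hq1 hq u r hu0 hu1 hr1 hrlim hrec hb
  have h6 := hulim.const_sub 1
  rw [sub_sub_cancel] at h6
  refine h6.congr fun t => ?_
  rw [hxu, mul_div_cancel_left₀ _ (hxpos t).ne']
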